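/- Let Λ be a set and let Γ be a subshift of Λ^ω. Then Γ is a subshift of bounded type if and only if the system (Γ, σ) has the shadowing property with respect to the metric d(x,y) = inf{2^{-n} : x_i = y_i for all i < n}. -/

import Mathlib

open Set Filter Topology

/-- The shift map `σ` on `ℕ → Λ`, defined by `σ(x)(n) = x(n+1)`. -/
def shift {Λ : Type*} (x : ℕ → Λ) : ℕ → Λ := fun n => x (n + 1)

/-- The Baire metric `d(x,y) = inf {2^{-n} : x_i = y_i for all i < n}`. -/
noncomputable def bDist {Λ : Type*} (x y : ℕ → Λ) : ℝ :=
  sInf {r : ℝ | ∃ n : ℕ, r = (2 : ℝ)⁻¹ ^ n ∧ ∀ i < n, x i = y i}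

/-- `Γ` is a subshift: a closed, shift-invariant subset of `ℕ → Λ`. -/
def IsSubshift {Λ : Type*} [TopologicalSpace Λ] (Γ : Set (ℕ → Λ)) : Prop :=
  IsClosed Γ ∧ shift '' Γ = Γ

/-- The finite word `w` is allowed in `Γ`: it occurs as a consecutive block in some point of `Γ`. -/
def Allowed {Λ : Type*} (Γ : Set (ℕ → Λ)) (w : List Λ) : Prop :=
  ∃ x ∈ Γ, ∃ i : ℕ, ∀ (j : ℕ) (h : j < w.length), x (i + j) = w.get ⟨j, h⟩

/-- `F` is a basis for the forbidden words of `Γ`: each member of `F` is forbidden, and every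
forbidden word contains a member of `F` as a consecutive (infix) subword. -/
def IsForbiddenBasis {Λ : Type*} (Γ : Set (ℕ → Λ)) (F : Set (List Λ)) : Prop :=
  (∀ w ∈ F, ¬ Allowed Γ w) ∧ ∀ w : List Λ, ¬ Allowed Γ w → ∃ v ∈ F, v <:+: w

/-- `Γ` is a subshift of finite type: it has a finite basis for its forbidden words. -/
def IsSFT {Λ : Type*} (Γ : Set (ℕ → Λ)) : Prop :=
  ∃ F : Set (List Λ), F.Finite ∧ IsForbiddenBasis Γ F

/-- `Γ` is a subshift of bounded type: it has a basis for its forbidden words whose members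
have uniformly bounded length. -/
def IsSBT {Λ : Type*} (Γ : Set (ℕ → Λ)) : Prop :=
  ∃ F : Set (List Λ), (∃ N : ℕ, ∀ w ∈ F, w.length ≤ N) ∧ IsForbiddenBasis Γ F

/-- `(Γ, σ)` has the shadowing property w.r.t. the Baire metric. -/
def HasShadowing {Λ : Type*} (Γ : Set (ℕ → Λ)) : Prop :=
  ∀ ε : ℝ, 0 < ε → ∃ δ : ℝ, 0 < δ ∧
    ∀ x : ℕ → (ℕ → Λ), (∀ i, x i ∈ Γ) →
      (∀ i, bDist (shift (x i)) (x (i + 1)) < δ) →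
      ∃ z ∈ Γ, ∀ i, bDist (shift^[i] z) (x i) < ε

theorem shift_iterate_apply {Λ : Type*} (x : ℕ → Λ) (n i : ℕ) : shift^[n] x i = x (i + n) := by
  induction n generalizing x with
  | zero => rfl
  | succ n ih => rw [Function.iterate_succ_apply, ih, shift, Nat.add_assoc]

theorem bDist_lt_pow_iff {Λ : Type*} (x y : ℕ → Λ) (k : ℕ) :
    bDist x y < (2 : ℝ)⁻¹ ^ k ↔ ∀ i ≤ k, x i = y i := by
  have h0 : (0 : ℝ) < 2⁻¹ := by norm_num
  have h1 : (2 : ℝ)⁻¹ < 1 := by norm_num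
  have hbdd : BddBelow {r : ℝ | ∃ n : ℕ, r = (2 : ℝ)⁻¹ ^ n ∧ ∀ i < n, x i = y i} := by
    refine ⟨0, ?_⟩
    rintro r ⟨n, rfl, -⟩
    positivity
  rw [bDist, csInf_lt_iff hbdd ⟨1, 0, by simp⟩]
  constructor
  · rintro ⟨r, ⟨n, rfl, hn⟩, hr⟩ i hi
    exact hn i (hi.trans_lt ((pow_lt_pow_iff_right_of_lt_one₀ h0 h1).1 hr))
  · intro h
    exact ⟨_, ⟨k + 1, rfl, fun i hi => h i (Nat.le_of_lt_succ hi)⟩,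
      (pow_lt_pow_iff_right_of_lt_one₀ h0 h1).2 k.lt_succ_self⟩

theorem iterate_shift_mem {Λ : Type*} {Γ : Set (ℕ → Λ)} (hΓ : shift '' Γ = Γ) {x : ℕ → Λ}
    (hx : x ∈ Γ) (n : ℕ) : shift^[n] x ∈ Γ :=
  (mapsTo_iff_image_subset.2 hΓ.subset).iterate n hx

/-- In a shift-invariant set, an allowed word occurs as a prefix of some point. -/
theorem Allowed.exists_prefix {Λ : Type*} {Γ : Set (ℕ → Λ)} (hΓ : shift '' Γ = Γ) {w : List Λ}
    (hw : Allowed Γ w) : ∃ x ∈ Γ, ∀ (j : ℕ) (h : j < w.length), x j = w[j] := by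
  obtain ⟨x, hx, i, hi⟩ := hw
  refine ⟨_, iterate_shift_mem hΓ hx i, fun j h => ?_⟩
  rw [shift_iterate_apply, Nat.add_comm]
  exact hi j h

/-- A closed set of sequences contains every sequence all of whose prefixes it realizes. -/
theorem IsClosed.mem_of_forall_prefix {Λ : Type*} [TopologicalSpace Λ]
    {Γ : Set (ℕ → Λ)} (hΓ : IsClosed Γ) {z : ℕ → Λ}
    (h : ∀ n, ∃ x ∈ Γ, ∀ j < n, x j = z j) : z ∈ Γ := by
  choose x hx hxz using h
  refine hΓ.mem_of_tendsto (f := x) (b := atTop) ?_ (Eventually.of_forall hx)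
  refine tendsto_pi_nhds.2 fun j => tendsto_const_nhds.congr' ?_
  filter_upwards [eventually_gt_atTop j] with n hn
  exact (hxz n j hn).symm

theorem IsSBT.hasShadowing {Λ : Type*} [TopologicalSpace Λ] {Γ : Set (ℕ → Λ)}
    (hΓ : IsSubshift Γ) (h : IsSBT Γ) : HasShadowing Γ := by
  obtain ⟨F, ⟨N, hN⟩, hF, hbasis⟩ := h
  intro ε hε
  obtain ⟨k, hk⟩ := exists_pow_lt_of_lt_one hε (by norm_num : (2 : ℝ)⁻¹ < 1)
  refine ⟨2⁻¹ ^ (max N k), by positivity, fun x hx hpseudo => ?_⟩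
  simp only [bDist_lt_pow_iff, shift] at hpseudo
  have hdiag : ∀ j ≤ max N k, ∀ i, x i j = x (i + j) 0 := by
    intro j
    induction j with
    | zero => intros; rfl
    | succ j ih =>
      intro hj i
      rw [hpseudo i j (by omega), ih (by omega), Nat.add_right_comm, Nat.add_assoc]
  refine ⟨fun i => x i 0, hΓ.1.mem_of_forall_prefix fun n => ?_, fun i => ?_⟩
  · have hallowed : Allowed Γ (List.ofFn fun j : Fin n => x j 0) := by
      by_contra hw
      obtain ⟨v, hv, s, t, hst⟩ := hbasis _ hw
      refine hF v hv ⟨x s.length, hx _, 0, fun j hj => ?_⟩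
      have hjN := hN v hv
      rw [Nat.zero_add, hdiag j (by omega)]
      have hlen := congrArg List.length hst
      simp only [List.length_append, List.length_ofFn] at hlen
      have hget : (List.ofFn fun j : Fin n => x j 0)[s.length + j]'(by simp; omega) = v[j] := by
        simp only [← hst]
        simp [hj]
      simpa using hget
    obtain ⟨y, hy, hyw⟩ := hallowed.exists_prefix hΓ.2
    exact ⟨y, hy, fun j hj => (hyw j (by simpa using hj)).trans (List.getElem_ofFn _)⟩
  · refine lt_trans ((bDist_lt_pow_iff _ _ k).2 fun j hj => ?_) hk
    rw [shift_iterate_apply, hdiag j (by omega), Nat.add_comm]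

theorem HasShadowing.isSBT {Λ : Type*} {Γ : Set (ℕ → Λ)}
    (hΓ : shift '' Γ = Γ) (h : HasShadowing Γ) : IsSBT Γ := by
  obtain ⟨δ, hδ, hshadow⟩ := h 1 one_pos
  obtain ⟨M, hM⟩ := exists_pow_lt_of_lt_one hδ (by norm_num : (2 : ℝ)⁻¹ < 1)
  refine ⟨{w | ¬ Allowed Γ w ∧ w.length ≤ M + 2}, ⟨M + 2, fun w hw => hw.2⟩,
    fun w hw => hw.1, fun w hw => ?_⟩
  by_contra! hsub
  have hshort : ∀ v, v <:+: w → v.length ≤ M + 2 → Allowed Γ v := fun v hv hlen => by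
    by_contra hva
    exact hsub v ⟨hva, hlen⟩ hv
  have hlong : M + 2 < w.length := by
    by_contra hle
    exact hw (hshort w List.infix_rfl (by omega))
  have hwindow : ∀ i, ∃ x ∈ Γ, ∀ j < M + 2, ∀ hij : i + j < w.length, x j = w[i + j] := by
    intro i
    obtain ⟨x, hx, hxw⟩ := (hshort ((w.drop i).take (M + 2))
      ((List.take_prefix _ _).isInfix.trans (List.drop_suffix _ _).isInfix)
      (by simp)).exists_prefix hΓ
    refine ⟨x, hx, fun j hj hij => ?_⟩
    rw [hxw j (by simp; omega), List.getElem_take, List.getElem_drop]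
  choose y hy hyw using hwindow
  -- The last window is continued by its own orbit.
  let L := w.length - (M + 2)
  let x : ℕ → ℕ → Λ := fun i => shift^[i - L] (y (min i L))
  have hxapply : ∀ i j, x i j = y (min i L) (j + (i - L)) := fun i j =>
    shift_iterate_apply _ _ _
  obtain ⟨z, hz, hzx⟩ := hshadow x (fun i => iterate_shift_mem hΓ (hy _) _) (fun i => by
    refine lt_trans ((bDist_lt_pow_iff _ _ M).2 fun j hj => ?_) hM
    rw [shift, hxapply, hxapply]
    rcases lt_or_ge i L with hi | hi
    · rw [hyw _ _ (by omega) (by omega), hyw _ _ (by omega) (by omega)]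
      congr 1
      omega
    · rw [min_eq_right hi, min_eq_right (by omega)]
      congr 1
      omega)
  refine hw ⟨z, hz, 0, fun i hi => ?_⟩
  have hzi := (bDist_lt_pow_iff _ _ 0).1 (by simpa using hzx i) 0 le_rfl
  rw [shift_iterate_apply, hxapply, hyw _ _ (by omega) (by omega)] at hzi
  rw [Nat.add_comm, ← Nat.add_comm 0, hzi, List.get_eq_getElem]
  congr 1
  simp only
  omega

/-- A subshift is of bounded type iff it has the shadowing property. -/
theorem sbt_iff_hasShadowing {Λ : Type*} [TopologicalSpace Λ] [DiscreteTopology Λ]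
    (Γ : Set (ℕ → Λ)) (hΓ : IsSubshift Γ) :
    IsSBT Γ ↔ HasShadowing Γ := by
  exact ⟨IsSBT.hasShadowing hΓ, HasShadowing.isSBT hΓ.2⟩
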